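/- Let R be a nontrivial commutative ring and let p be a minimal prime of R. Then the localization R_p has property (**) (i.e. there exist a nontrivial Noetherian ring S and a flat ring homomorphism S → R_p) if and only if there exists a subring S of R_p such that S is an Artinian local ring and R_p is a free S-module. -/

import Mathlib

universe u

open IsLocalRing TensorProduct in
/-- Nakayama's lemma for an arbitrary module over a local ring with nilpotent maximal ideal:
lifts of a spanning family of the special fibre span the module. -/
theorem IsLocalRing.eq_top_of_map_tensorProduct_mk_eq_top_of_isNilpotent {A M : Type*}
    [CommRing A] [IsLocalRing A] [AddCommGroup M] [Module A M]
    (hA : IsNilpotent (maximalIdeal A)) {N : Submodule A M}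
    (hN : N.map (TensorProduct.mk A (ResidueField A) M 1) = ⊤) : N = ⊤ := by
  have sup_eq : N ⊔ maximalIdeal A • ⊤ = ⊤ := by
    refine eq_top_iff.mpr fun x _ ↦ ?_
    obtain ⟨y, hy, hxy⟩ : (1 : ResidueField A) ⊗ₜ[A] x ∈
        N.map (TensorProduct.mk A (ResidueField A) M 1) := hN ▸ Submodule.mem_top
    have key : (Submodule.Quotient.mk y : M ⧸ (maximalIdeal A • ⊤ : Submodule A M)) =
        Submodule.Quotient.mk x :=
      ((quotTensorEquivQuotSMul_mk_one_tmul _ y).symm.trans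
        (congrArg (quotTensorEquivQuotSMul M (maximalIdeal A)) hxy)).trans
        (quotTensorEquivQuotSMul_mk_one_tmul _ x)
    rw [eq_comm, Submodule.Quotient.eq] at key
    exact Submodule.mem_sup.mpr ⟨y, hy, x - y, key, by abel⟩
  have sup_pow_eq (n : ℕ) : N ⊔ maximalIdeal A ^ n • ⊤ = ⊤ := by
    induction n with
    | zero => simp
    | succ n ih =>
      refine eq_top_iff.mpr (sup_eq.symm.le.trans (sup_le le_sup_left ?_))
      conv_lhs => rw [← ih]
      rw [Submodule.smul_sup, pow_succ', mul_smul]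
      exact sup_le_sup_right Submodule.smul_le_right _
  obtain ⟨n, hn⟩ := hA
  simpa [hn] using sup_pow_eq n

open IsLocalRing TensorProduct in
/-- A flat module over an Artinian local ring is free. -/
theorem Module.free_of_flat_of_isArtinianRing {A M : Type*} [CommRing A] [IsLocalRing A]
    [IsArtinianRing A] [AddCommGroup M] [Module A M] [Module.Flat A M] : Module.Free A M := by
  let w := Module.Free.chooseBasis (ResidueField A) (ResidueField A ⊗[A] M)
  obtain ⟨v, hv⟩ := (TensorProduct.mk_surjective A M (ResidueField A)
    Ideal.Quotient.mk_surjective).comp_left w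
  replace hv : TensorProduct.mk A (ResidueField A) M 1 ∘ v = w := hv
  have hA : IsNilpotent (maximalIdeal A) := by
    rw [← IsLocalRing.jacobson_eq_maximalIdeal ⊥ bot_ne_top]
    exact IsArtinianRing.isNilpotent_jacobson_bot
  refine .of_basis (.mk (Module.IsLocalRing.linearIndependent_of_flat v
    (by rw [hv]; exact w.linearIndependent)) (eq_top_iff.mp ?_))
  apply eq_top_of_map_tensorProduct_mk_eq_top_of_isNilpotent hA
  rw [Submodule.map_span, ← Set.range_comp, hv,
    ← Submodule.restrictScalars_span A (ResidueField A) Ideal.Quotient.mk_surjective,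
    w.span_eq, Submodule.restrictScalars_top]

/-- A flat ring homomorphism into a local ring factors through a flat local homomorphism from the
localization at the preimage of the maximal ideal. -/
theorem RingHom.Flat.exists_flat_isLocalHom {S B : Type u} [CommRing S] [CommRing B]
    [IsLocalRing B] {φ : S →+* B} (hφ : φ.Flat) :
    ∃ ψ : Localization.AtPrime ((IsLocalRing.maximalIdeal B).comap φ) →+* B,
      ψ.Flat ∧ IsLocalHom ψ := by
  set q := (IsLocalRing.maximalIdeal B).comap φ
  have hunit (s : S) : IsUnit (φ s) ↔ s ∈ q.primeCompl := by
    simp [q, Ideal.primeCompl]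
  let ψ : Localization.AtPrime q →+* B :=
    IsLocalization.lift (M := q.primeCompl) (g := φ) fun s ↦ (hunit s).mpr s.2
  have hψ : ψ.comp (algebraMap S _) = φ := IsLocalization.lift_comp _
  refine ⟨ψ, ?_, ⟨fun x hx ↦ ?_⟩⟩
  · algebraize [φ, ψ]
    have : IsScalarTower S (Localization.AtPrime q) B := .of_algebraMap_eq' hψ.symm
    rw [RingHom.Flat, Module.flat_iff_of_isLocalization
      (S := Localization.AtPrime q) (p := q.primeCompl)]
    infer_instance
  · obtain ⟨s, t, rfl⟩ := IsLocalization.exists_mk'_eq q.primeCompl x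
    rw [IsLocalization.AtPrime.isUnit_mk'_iff _ q, ← hunit]
    rw [← hψ, RingHom.comp_apply, ← IsLocalization.mk'_spec _ s t, map_mul]
    refine hx.mul ?_
    exact (IsLocalization.map_units _ t).map ψ

/-- If a zero-dimensional local ring is flat over a Noetherian ring, then it is free
over an Artinian local subring. -/
theorem RingHom.Flat.exists_subring_isArtinianRing_free {S B : Type u} [CommRing S]
    [IsNoetherianRing S] [CommRing B] [IsLocalRing B] [Ring.KrullDimLE 0 B] {φ : S →+* B}
    (hφ : φ.Flat) :
    ∃ T : Subring B, IsArtinianRing T ∧ IsLocalRing T ∧ Module.Free T B := by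
  obtain ⟨ψ, hψ, hloc⟩ := hφ.exists_flat_isLocalHom
  set q := (IsLocalRing.maximalIdeal B).comap φ
  have hff : ψ.FaithfullyFlat := by
    algebraize [ψ]
    exact Module.FaithfullyFlat.of_flat_of_isLocalHom
  have hdim : Ring.KrullDimLE 0 (Localization.AtPrime q) := by
    refine .mk₀ fun I hI ↦ ?_
    obtain ⟨J, hJ⟩ := (RingHom.FaithfullyFlat.iff_flat_and_comap_surjective.mp hff).2 ⟨I, hI⟩
    have hJmax := IsLocalRing.eq_maximalIdeal (Ideal.isMaximal_of_isPrime J.asIdeal)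
    have hI : I = J.asIdeal.comap ψ := congrArg PrimeSpectrum.asIdeal hJ.symm
    have hcomap : (IsLocalRing.maximalIdeal B).comap ψ = IsLocalRing.maximalIdeal _ :=
      ((IsLocalRing.local_hom_TFAE ψ).out 0 4).mp hloc
    rw [hI, hJmax, hcomap]
    infer_instance
  have : IsNoetherianRing (Localization.AtPrime q) :=
    IsLocalization.isNoetherianRing q.primeCompl _ inferInstance
  have : IsArtinianRing (Localization.AtPrime q) :=
    IsNoetherianRing.isArtinianRing_of_krullDimLE_zero
  let e : Localization.AtPrime q ≃+* ψ.range :=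
    .ofBijective ψ.rangeRestrict
      ⟨fun _ _ h ↦ hff.injective (congrArg Subtype.val h), ψ.rangeRestrict_surjective⟩
  have hart : IsArtinianRing ψ.range := e.surjective.isArtinianRing
  have hlocal : IsLocalRing ψ.range := e.isLocalRing
  have hflat : Module.Flat ψ.range B := by
    have h : ψ.range.subtype = ψ.comp (e.symm : ψ.range →+* _) := by
      ext x
      obtain ⟨y, rfl⟩ := e.surjective x
      simp only [RingHom.comp_apply, RingHom.coe_coe, e.symm_apply_apply]
      rfl
    have : ψ.range.subtype.Flat := h ▸ .comp (.of_bijective e.symm.bijective) hψ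
    exact RingHom.flat_algebraMap_iff.mp this
  exact ⟨ψ.range, hart, hlocal, Module.free_of_flat_of_isArtinianRing⟩

/-- Let `p` be a minimal prime of a nontrivial commutative ring `R`. Then `R_p` has property
(**) iff there is a subring `S` of `R_p` which is an Artinian local ring and such that `R_p`
is free as an `S`-module. -/
theorem stmt9 {R : Type u} [CommRing R] [Nontrivial R] (p : Ideal R) [p.IsPrime]
    (hp : p ∈ minimalPrimes R) :
    (∃ (S : Type u) (_ : CommRing S), Nontrivial S ∧ IsNoetherianRing S ∧
        ∃ φ : S →+* Localization.AtPrime p, φ.Flat) ↔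
      ∃ S : Subring (Localization.AtPrime p), IsArtinianRing S ∧ IsLocalRing S ∧
        Module.Free S (Localization.AtPrime p) := by
  have := Ring.KrullDimLE.of_isLocalization p hp (Localization.AtPrime p)
  constructor
  · rintro ⟨S, _, _, _, φ, hφ⟩
    exact hφ.exists_subring_isArtinianRing_free
  · rintro ⟨S, _, _, _⟩
    exact ⟨S, inferInstance, inferInstance, inferInstance, algebraMap S _,
      RingHom.flat_algebraMap_iff.mpr inferInstance⟩
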